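/- Let A and B be two disjoint finite subsets of Z² such that A, B, and A ∪ B are all connected in the lattice Z². Let Δ_A = {e ∈ E²_* : s(e) ∩ A ≠ ∅} and Δ_B = {e ∈ E²_* : s(e) ∩ B ≠ ∅}, and let Γ(A∪B) ⊆ E²_* be the cycle of dual edges surrounding A∪B (the set of dual edges forming the boundary of the infinite connected component of the complement of (A∪B) + [−1/2,1/2]² in ℝ²). Then E^A = Γ(A∪B) ∩ Δ_A and E^B = Γ(A∪B) ∩ Δ_B are both connected sets of dual edges. -/

import Mathlib

/-! Lemma on Peierls contours in `ℤ²`: if `A`, `B` and `A ∪ B` are connected,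
the parts of the surrounding contour `Γ(A ∪ B)` touching `A` and touching `B`
are both connected sets of dual edges. -/

/-- Nearest-neighbour adjacency on `ℤ²`. -/
def adj2 (x y : ℤ × ℤ) : Prop := (x.1 - y.1).natAbs + (x.2 - y.2).natAbs = 1

/-- A dual edge: an unordered pair of adjacent dual vertices.  A dual vertex
`z + (1/2, 1/2)` is represented by its base point `z ∈ ℤ²`. -/
def IsDualEdge (e : Sym2 (ℤ × ℤ)) : Prop := ∃ a b, adj2 a b ∧ e = s(a, b)

/-- `s(e)`: the pair of primal vertices `{i, j}` such that the quadrangle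
`a i b j` is a unit square, for the dual edge `e = {a, b}`. -/
def sMap (e : Sym2 (ℤ × ℤ)) : Set (ℤ × ℤ) :=
  {v | ∃ w a b, adj2 v w ∧ e = s(a, b) ∧ v + w = a + b + (1, 1)}

/-- The real position of the dual vertex with base point `z`. -/
noncomputable def dualPos (z : ℤ × ℤ) : ℝ × ℝ := ((z.1 : ℝ) + 1 / 2, (z.2 : ℝ) + 1 / 2)

/-- The segment of the plane drawn by a dual edge. -/
def edgeSeg (e : Sym2 (ℤ × ℤ)) : Set (ℝ × ℝ) :=
  {x | ∃ a b, e = s(a, b) ∧ x ∈ segment ℝ (dualPos a) (dualPos b)}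

/-- `A + [−1/2, 1/2]²` as a subset of the plane. -/
def fat (A : Set (ℤ × ℤ)) : Set (ℝ × ℝ) :=
  {x | ∃ v ∈ A, |x.1 - (v.1 : ℝ)| ≤ 1 / 2 ∧ |x.2 - (v.2 : ℝ)| ≤ 1 / 2}

/-- `A ⊆ ℤ²` is connected in the lattice `𝕃²`. -/
def conn2 (A : Set (ℤ × ℤ)) : Prop :=
  ∀ x ∈ A, ∀ y ∈ A, Relation.ReflTransGen (fun u v => u ∈ A ∧ v ∈ A ∧ adj2 u v) x y

/-- A set `F` of (dual) edges is connected: the graph formed by these edges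
and their endpoints is connected. -/
def edgeConn (F : Set (Sym2 (ℤ × ℤ))) : Prop :=
  ∀ e ∈ F, ∀ e' ∈ F,
    Relation.ReflTransGen (fun f g => f ∈ F ∧ g ∈ F ∧ ∃ v, v ∈ f ∧ v ∈ g) e e'

namespace CPC

/-- The dual edge `e` separates the two primal vertices `i` and `j`. -/
def Cross (e : Sym2 (ℤ × ℤ)) (i j : ℤ × ℤ) : Prop :=
  ∃ a : ℤ × ℤ,
    (e = s(a, (a.1 + 1, a.2)) ∧ i = (a.1 + 1, a.2) ∧ j = (a.1 + 1, a.2 + 1)) ∨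
    (e = s(a, (a.1, a.2 + 1)) ∧ i = (a.1, a.2 + 1) ∧ j = (a.1 + 1, a.2 + 1))

lemma adj2_symm {u v : ℤ × ℤ} (h : adj2 u v) : adj2 v u := by
  unfold adj2 at *; omega

lemma adj2_cases {u v : ℤ × ℤ} (h : adj2 u v) :
    v = (u.1 + 1, u.2) ∨ v = (u.1 - 1, u.2) ∨ v = (u.1, u.2 + 1) ∨ v = (u.1, u.2 - 1) := by
  obtain ⟨a, b⟩ := u
  obtain ⟨c, d⟩ := v
  simp only [adj2, Prod.mk.injEq] at *
  omega

lemma cross_of_dualEdge {e : Sym2 (ℤ × ℤ)} (h : IsDualEdge e) : ∃ i j, Cross e i j := by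
  obtain ⟨a, b, hab, rfl⟩ := h
  rcases adj2_cases hab with rfl | rfl | rfl | rfl
  · exact ⟨_, _, a, Or.inl ⟨rfl, rfl, rfl⟩⟩
  · exact ⟨_, _, (a.1 - 1, a.2), Or.inl ⟨by simp [Sym2.eq_swap], rfl, rfl⟩⟩
  · exact ⟨_, _, a, Or.inr ⟨rfl, rfl, rfl⟩⟩
  · exact ⟨_, _, (a.1, a.2 - 1), Or.inr ⟨by simp [Sym2.eq_swap], rfl, rfl⟩⟩

lemma Cross.isDualEdge {e : Sym2 (ℤ × ℤ)} {i j : ℤ × ℤ} (h : Cross e i j) : IsDualEdge e := by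
  obtain ⟨a, ⟨rfl, -, -⟩ | ⟨rfl, -, -⟩⟩ := h
  · exact ⟨_, _, by simp [adj2], rfl⟩
  · exact ⟨_, _, by simp [adj2], rfl⟩

lemma Cross.adj {e : Sym2 (ℤ × ℤ)} {i j : ℤ × ℤ} (h : Cross e i j) : adj2 i j := by
  obtain ⟨a, ⟨-, rfl, rfl⟩ | ⟨-, rfl, rfl⟩⟩ := h <;> simp [adj2]

lemma Cross.sMap {e : Sym2 (ℤ × ℤ)} {i j : ℤ × ℤ} (h : Cross e i j) : sMap e = {i, j} := by
  ext ⟨v1, v2⟩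
  simp only [_root_.sMap, Set.mem_ofPred_eq, Set.mem_insert_iff, Set.mem_singleton_iff]
  obtain ⟨⟨a1, a2⟩, ⟨rfl, rfl, rfl⟩ | ⟨rfl, rfl, rfl⟩⟩ := h
  · constructor
    · rintro ⟨⟨w1, w2⟩, ⟨p1, p2⟩, ⟨q1, q2⟩, hadj, he, hs⟩
      simp only [adj2, Sym2.eq_iff, Prod.mk.injEq, Prod.mk_add_mk] at *
      omega
    · rintro (h | h)
      · refine ⟨(a1 + 1, a2 + 1), (a1, a2), (a1 + 1, a2), ?_, rfl, ?_⟩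
        · simp only [h]; simp [adj2]
        · simp only [h, Prod.mk_add_mk, Prod.mk.injEq]; omega
      · refine ⟨(a1 + 1, a2), (a1, a2), (a1 + 1, a2), ?_, rfl, ?_⟩
        · simp only [h]; simp [adj2]
        · simp only [h, Prod.mk_add_mk, Prod.mk.injEq]; omega
  · constructor
    · rintro ⟨⟨w1, w2⟩, ⟨p1, p2⟩, ⟨q1, q2⟩, hadj, he, hs⟩
      simp only [adj2, Sym2.eq_iff, Prod.mk.injEq, Prod.mk_add_mk] at *
      omega
    · rintro (h | h)
      · refine ⟨(a1 + 1, a2 + 1), (a1, a2), (a1, a2 + 1), ?_, rfl, ?_⟩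
        · simp only [h]; simp [adj2]
        · simp only [h, Prod.mk_add_mk, Prod.mk.injEq]; omega
      · refine ⟨(a1, a2 + 1), (a1, a2), (a1, a2 + 1), ?_, rfl, ?_⟩
        · simp only [h]; simp [adj2]
        · simp only [h, Prod.mk_add_mk, Prod.mk.injEq]; omega

/-- A dual edge is determined by the pair of primal vertices it separates. -/
lemma Cross.inj {e e' : Sym2 (ℤ × ℤ)} {i j i' j' : ℤ × ℤ} (h : Cross e i j)
    (h' : Cross e' i' j') (hs : s(i, j) = s(i', j')) : e = e' := by
  obtain ⟨⟨a1, a2⟩, ⟨rfl, rfl, rfl⟩ | ⟨rfl, rfl, rfl⟩⟩ := h <;>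
  obtain ⟨⟨b1, b2⟩, ⟨rfl, rfl, rfl⟩ | ⟨rfl, rfl, rfl⟩⟩ := h' <;>
  simp only [Sym2.eq_iff, Prod.mk.injEq] at * <;> omega

/-- The vertices separated by a dual edge are determined by it. -/
lemma Cross.uniq {e : Sym2 (ℤ × ℤ)} {i j i' j' : ℤ × ℤ} (h : Cross e i j)
    (h' : Cross e i' j') : i = i' ∧ j = j' := by
  obtain ⟨⟨a1, a2⟩, ⟨rfl, rfl, rfl⟩ | ⟨rfl, rfl, rfl⟩⟩ := h <;>
  obtain ⟨⟨b1, b2⟩, ⟨h, rfl, rfl⟩ | ⟨h, rfl, rfl⟩⟩ := h' <;>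
  simp only [Sym2.eq_iff, Prod.mk.injEq] at * <;> omega

/-- Number (mod 2) of crossings of the step `u → v` with the upward ray from the dual vertex `f`. -/
def stepF (u v f : ℤ × ℤ) : ZMod 2 :=
  if u.2 = v.2 ∧ min u.1 v.1 = f.1 ∧ f.2 < u.2 then 1 else 0

/-- Indicator of the upward half line. -/
def ray (m k : ℤ) (u : ℤ × ℤ) : ZMod 2 := if u.1 = m ∧ k < u.2 then 1 else 0

lemma two0 (x : ZMod 2) : x + x = 0 := CharTwo.add_self_eq_zero x

lemma stepF_V {u v : ℤ × ℤ} (h : adj2 u v) (m k : ℤ) :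
    stepF u v (m, k) + stepF u v (m, k + 1) =
      if s((m, k + 1), (m + 1, k + 1)) = s(u, v) then 1 else 0 := by
  obtain ⟨u1, u2⟩ := u
  obtain ⟨v1, v2⟩ := v
  simp only [adj2, stepF, Sym2.eq_iff, Prod.mk.injEq] at *
  split_ifs <;> first | rfl | (exfalso; omega)

lemma stepF_H {u v : ℤ × ℤ} (h : adj2 u v) (m k : ℤ) :
    stepF u v (m, k) + stepF u v (m + 1, k) =
      ray (m + 1) k u + ray (m + 1) k v +
      if s((m + 1, k), (m + 1, k + 1)) = s(u, v) then 1 else 0 := by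
  rcases adj2_cases h with rfl | rfl | rfl | rfl <;>
  obtain ⟨u1, u2⟩ := u <;>
  simp only [stepF, ray, Sym2.eq_iff, Prod.mk.injEq, true_and] at * <;>
  split_ifs <;> first | rfl | (exfalso; omega)

lemma walk_F (P : Set (ℤ × ℤ)) (x y : ℤ × ℤ)
    (h : Relation.ReflTransGen (fun u v => u ∈ P ∧ v ∈ P ∧ adj2 u v) x y) :
    ∃ F : ℤ × ℤ → ZMod 2,
      (∀ m k, ¬ ((m, k + 1) ∈ P ∧ (m + 1, k + 1) ∈ P) → F (m, k) + F (m, k + 1) = 0) ∧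
      (∀ m k, ¬ ((m + 1, k) ∈ P ∧ (m + 1, k + 1) ∈ P) →
        F (m, k) + F (m + 1, k) = ray (m + 1) k x + ray (m + 1) k y) := by
  induction h with
  | refl => exact ⟨0, by simp, by simp [two0]⟩
  | @tail u v _ huv ih =>
    obtain ⟨F, hV, hH⟩ := ih
    obtain ⟨hu, hv, hadj⟩ := huv
    refine ⟨fun f => F f + stepF u v f, fun m k hn => ?_, fun m k hn => ?_⟩
    · have h1 := hV m k hn
      have h2 := stepF_V hadj m k
      rw [if_neg] at h2
      · linear_combination h1 + h2
      · intro hs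
        rw [Sym2.eq_iff] at hs
        rcases hs with ⟨rfl, rfl⟩ | ⟨rfl, rfl⟩ <;> exact hn ⟨by assumption, by assumption⟩
    · have h1 := hH m k hn
      have h2 := stepF_H hadj m k
      rw [if_neg] at h2
      · linear_combination h1 + h2 + two0 (ray (m + 1) k u)
      · intro hs
        rw [Sym2.eq_iff] at hs
        rcases hs with ⟨rfl, rfl⟩ | ⟨rfl, rfl⟩ <;> exact hn ⟨by assumption, by assumption⟩

/-- The coboundary of `F` on a dual edge. -/
def bnd (F : ℤ × ℤ → ZMod 2) (e : Sym2 (ℤ × ℤ)) : ZMod 2 := ∑ a ∈ e.toFinset, F a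

lemma bnd_mk (F : ℤ × ℤ → ZMod 2) {a b : ℤ × ℤ} (h : a ≠ b) : bnd F s(a, b) = F a + F b := by
  have : (s(a, b) : Sym2 (ℤ × ℤ)).toFinset = {a, b} := by ext; simp
  rw [bnd, this, Finset.sum_pair h]

lemma cycle_F (A D : Set (ℤ × ℤ)) (hA : conn2 A) (hD : conn2 D) {a₁ a₂ d₁ d₂ : ℤ × ℤ}
    (ha₁ : a₁ ∈ A) (ha₂ : a₂ ∈ A) (hd₁ : d₁ ∈ D) (hd₂ : d₂ ∈ D)
    (h1 : adj2 a₁ d₁) (h2 : adj2 a₂ d₂) :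
    ∃ F : ℤ × ℤ → ZMod 2, ∀ e i j, Cross e i j → ¬ (i ∈ A ∧ j ∈ A) → ¬ (i ∈ D ∧ j ∈ D) →
      bnd F e = (if s(i, j) = s(a₁, d₁) then 1 else 0) +
        (if s(i, j) = s(a₂, d₂) then 1 else 0) := by
  obtain ⟨FA, hAV, hAH⟩ := walk_F A a₁ a₂ (hA _ ha₁ _ ha₂)
  obtain ⟨FD, hDV, hDH⟩ := walk_F D d₁ d₂ (hD _ hd₁ _ hd₂)
  refine ⟨fun f => FA f + FD f + stepF a₁ d₁ f + stepF a₂ d₂ f, ?_⟩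
  rintro e i j ⟨⟨m, k⟩, ⟨rfl, rfl, rfl⟩ | ⟨rfl, rfl, rfl⟩⟩ hnA hnD
  · rw [bnd_mk _ (by simp)]
    have e1 := hAH m k hnA
    have e2 := hDH m k hnD
    have e3 := stepF_H h1 m k
    have e4 := stepF_H h2 m k
    dsimp only
    linear_combination e1 + e2 + e3 + e4 + two0 (ray (m + 1) k a₁) + two0 (ray (m + 1) k a₂)
      + two0 (ray (m + 1) k d₁) + two0 (ray (m + 1) k d₂)
  · rw [bnd_mk _ (by simp)]
    have e1 := hAV m k hnA
    have e2 := hDV m k hnD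
    have e3 := stepF_V h1 m k
    have e4 := stepF_V h2 m k
    dsimp only
    linear_combination e1 + e2 + e3 + e4

/-- The dual edges separating a point of `A` from a point of `D`. -/
def cut (A D : Set (ℤ × ℤ)) : Set (Sym2 (ℤ × ℤ)) :=
  {e | ∃ i j, Cross e i j ∧ (i ∈ A ∧ j ∈ D ∨ j ∈ A ∧ i ∈ D)}

lemma mem_cut {A D : Set (ℤ × ℤ)} {e i j} (h : Cross e i j) :
    e ∈ cut A D ↔ (i ∈ A ∧ j ∈ D ∨ j ∈ A ∧ i ∈ D) := by
  constructor
  · rintro ⟨i', j', h', hh⟩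
    obtain ⟨rfl, rfl⟩ := h.uniq h'
    exact hh
  · exact fun hh => ⟨i, j, h, hh⟩

lemma crossH (m k : ℤ) : Cross s((m, k), (m + 1, k)) (m + 1, k) (m + 1, k + 1) :=
  ⟨(m, k), Or.inl ⟨rfl, rfl, rfl⟩⟩

lemma crossV (m k : ℤ) : Cross s((m, k), (m, k + 1)) (m, k + 1) (m + 1, k + 1) :=
  ⟨(m, k), Or.inr ⟨rfl, rfl, rfl⟩⟩

lemma cut_finite (A D : Set (ℤ × ℤ)) (hA : A.Finite) : (cut A D).Finite := by
  have : cut A D ⊆ ⋃ v ∈ A, {s(((v.1 - 1 : ℤ), v.2), (v.1, v.2)),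
      s(((v.1 - 1 : ℤ), (v.2 - 1 : ℤ)), (v.1, (v.2 - 1 : ℤ))),
      s((v.1, (v.2 - 1 : ℤ)), (v.1, v.2)),
      s(((v.1 - 1 : ℤ), (v.2 - 1 : ℤ)), ((v.1 - 1 : ℤ), v.2))} := by
    rintro e ⟨i, j, ⟨⟨m, k⟩, ⟨rfl, rfl, rfl⟩ | ⟨rfl, rfl, rfl⟩⟩, ⟨h, -⟩ | ⟨h, -⟩⟩ <;>
    refine Set.mem_biUnion h ?_ <;> simp
  refine Set.Finite.subset (hA.biUnion fun v _ => ?_) this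
  exact Set.toFinite _

end CPC
namespace CPC

lemma crossH' (m k : ℤ) : Cross s((m - 1, k), (m, k)) (m, k) (m, k + 1) := by
  simpa using crossH (m - 1) k

lemma crossV' (m k : ℤ) : Cross s((m, k - 1), (m, k)) (m, k) (m + 1, k) := by
  simpa using crossV m (k - 1)

/-- `F` is constant on dual vertices touching `B`. -/
lemma const_on_B (B : Set (ℤ × ℤ)) (hB : conn2 B) (F : ℤ × ℤ → ZMod 2)
    (h0 : ∀ e i j, Cross e i j → (i ∈ B ∨ j ∈ B) → bnd F e = 0) :
    ∃ c, ∀ m k, (m, k) ∈ B → F (m, k) = c ∧ F (m - 1, k) = c ∧ F (m, k - 1) = c ∧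
      F (m - 1, k - 1) = c := by
  have eq_of : ∀ x y : ZMod 2, x + y = 0 → x = y := by decide
  have loc : ∀ m k, (m, k) ∈ B → F (m - 1, k) = F (m, k) ∧ F (m, k - 1) = F (m, k) ∧
      F (m - 1, k - 1) = F (m, k) := by
    intro m k hv
    have h1 := h0 _ _ _ (crossH' m k) (Or.inl hv)
    have h2 := h0 _ _ _ (crossV' m k) (Or.inl hv)
    have h3 := h0 _ _ _ (crossH' m (k - 1)) (Or.inr (by simpa using hv))
    rw [bnd_mk _ (by simp)] at h1 h2 h3
    have h1 := eq_of _ _ h1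
    have h2 := eq_of _ _ h2
    have h3 := eq_of _ _ h3
    exact ⟨h1, h2, h3.trans h2⟩
  have step : ∀ u ∈ B, ∀ v ∈ B, adj2 u v → F u = F v := by
    rintro ⟨m, k⟩ hu v hv hadj
    rcases adj2_cases hadj with rfl | rfl | rfl | rfl
    · simpa using (loc _ _ hv).1
    · simpa using (loc _ _ hu).1.symm
    · simpa using (loc _ _ hv).2.1
    · simpa using (loc _ _ hu).2.1.symm
  rcases B.eq_empty_or_nonempty with rfl | ⟨v0, hv0⟩
  · exact ⟨0, by simp⟩
  · refine ⟨F v0, fun m k hv => ?_⟩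
    have key : F (m, k) = F v0 := by
      have := hB v0 hv0 (m, k) hv
      generalize (m, k) = w at this
      induction this with
      | refl => rfl
      | tail _ h ih => rw [← ih, step _ h.1 _ h.2.1 h.2.2]
    obtain ⟨h1, h2, h3⟩ := loc m k hv
    simp [h1, h2, h3, key]

open Classical in
/-- Parity of the cut at a dual vertex not touching `B`. -/
lemma parity (A B D : Set (ℤ × ℤ)) (hAD : Disjoint A D)
    (hbd : ∀ u ∈ D, ∀ v, adj2 u v → v ∉ D → v ∈ A ∪ B) (m k : ℤ)
    (h00 : (m, k) ∉ B) (h10 : (m + 1, k) ∉ B) (h01 : (m, k + 1) ∉ B)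
    (h11 : (m + 1, k + 1) ∉ B) :
    ((({s((m, k), (m + 1, k)), s((m - 1, k), (m, k)), s((m, k), (m, k + 1)),
      s((m, k - 1), (m, k))} : Finset (Sym2 (ℤ × ℤ))).filter (· ∈ cut A D)).card : ZMod 2) = 0 := by
  have key : ∀ e i j, Cross e i j → i ∉ B → j ∉ B → (e ∈ cut A D ↔ ¬ (i ∈ D ↔ j ∈ D)) := by
    intro e i j hc hi hj
    rw [mem_cut hc]
    have hd := Set.disjoint_left.1 hAD
    have h1 := hbd i
    have h2 := hbd j
    have a1 := hc.adj
    have a2 := adj2_symm a1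
    constructor
    · rintro (⟨p, q⟩ | ⟨p, q⟩)
      · have := hd p; tauto
      · have := hd p; tauto
    · intro h
      by_cases hiD : i ∈ D
      · have hjD : j ∉ D := by tauto
        rcases h1 hiD j a1 hjD with h | h
        · exact Or.inr ⟨h, hiD⟩
        · exact absurd h hj
      · have hjD : j ∈ D := by tauto
        rcases h2 hjD i a2 hiD with h | h
        · exact Or.inl ⟨h, hjD⟩
        · exact absurd h hi
  have k1 := key _ _ _ (crossH m k) h10 h11
  have k2 := key _ _ _ (crossH' m k) h00 h01
  have k3 := key _ _ _ (crossV m k) h01 h11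
  have k4 := key _ _ _ (crossV' m k) h00 h10
  rw [Finset.card_filter, Nat.cast_sum, Finset.sum_insert, Finset.sum_insert, Finset.sum_insert,
    Finset.sum_singleton, if_congr k1 rfl rfl, if_congr k2 rfl rfl, if_congr k3 rfl rfl,
    if_congr k4 rfl rfl]
  · by_cases c00 : (m, k) ∈ D <;> by_cases c10 : (m + 1, k) ∈ D <;>
    by_cases c01 : (m, k + 1) ∈ D <;> by_cases c11 : (m + 1, k + 1) ∈ D <;>
    simp only [c00, c10, c01, c11, iff_true, iff_false, not_true, not_false_eq_true,
      if_true, if_false] <;> rfl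
  all_goals
    simp only [Finset.mem_insert, Finset.mem_singleton, Sym2.eq_iff, Prod.mk.injEq]
    omega

lemma mem_four {e : Sym2 (ℤ × ℤ)} {m k : ℤ} (he : IsDualEdge e) (h : (m, k) ∈ e) :
    e ∈ ({s((m, k), (m + 1, k)), s((m - 1, k), (m, k)), s((m, k), (m, k + 1)),
      s((m, k - 1), (m, k))} : Finset (Sym2 (ℤ × ℤ))) := by
  simp only [Finset.mem_insert, Finset.mem_singleton]
  obtain ⟨i, j, ⟨⟨a, b⟩, ⟨rfl, -⟩ | ⟨rfl, -⟩⟩⟩ := cross_of_dualEdge he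
  · rcases Sym2.mem_iff.1 h with h | h
    · obtain ⟨rfl, rfl⟩ := Prod.mk.inj h
      exact Or.inl rfl
    · obtain ⟨rfl, rfl⟩ := Prod.mk.inj h
      refine Or.inr (Or.inl ?_)
      simp
  · rcases Sym2.mem_iff.1 h with h | h
    · obtain ⟨rfl, rfl⟩ := Prod.mk.inj h
      exact Or.inr (Or.inr (Or.inl rfl))
    · obtain ⟨rfl, rfl⟩ := Prod.mk.inj h
      refine Or.inr (Or.inr (Or.inr ?_))
      simp

open Classical in
theorem cut_conn (A B D : Set (ℤ × ℤ)) (hAfin : A.Finite) (hA : conn2 A) (hB : conn2 B)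
    (hD : conn2 D) (hAB : Disjoint A B) (hAD : Disjoint A D) (hBD : Disjoint B D)
    (hbd : ∀ u ∈ D, ∀ v, adj2 u v → v ∉ D → v ∈ A ∪ B) : edgeConn (cut A D) := by
  intro e he e' he'
  by_contra hcon
  set r : Sym2 (ℤ × ℤ) → Sym2 (ℤ × ℤ) → Prop :=
    fun f g => f ∈ cut A D ∧ g ∈ cut A D ∧ ∃ v, v ∈ f ∧ v ∈ g with hr
  have hfin : {f | f ∈ cut A D ∧ Relation.ReflTransGen r e f}.Finite :=
    (cut_finite A D hAfin).subset fun f hf => hf.1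
  set C : Finset (Sym2 (ℤ × ℤ)) := hfin.toFinset with hC
  have memC : ∀ f, f ∈ C ↔ f ∈ cut A D ∧ Relation.ReflTransGen r e f := by
    intro f; rw [hC, Set.Finite.mem_toFinset]; rfl
  have heC : e ∈ C := (memC e).2 ⟨he, Relation.ReflTransGen.refl⟩
  have he'C : e' ∉ C := fun h => hcon ((memC e').1 h).2
  have ext : ∀ f ∈ cut A D, ∃ i j a d, Cross f i j ∧ a ∈ A ∧ d ∈ D ∧ s(i, j) = s(a, d) := by
    rintro f ⟨i, j, hc, ⟨h1, h2⟩ | ⟨h1, h2⟩⟩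
    · exact ⟨i, j, i, j, hc, h1, h2, rfl⟩
    · exact ⟨i, j, j, i, hc, h1, h2, Sym2.eq_swap⟩
  have sadj : ∀ i j a d : ℤ × ℤ, adj2 i j → s(i, j) = s(a, d) → adj2 a d := by
    intro i j a d h hs
    rcases Sym2.eq_iff.1 hs with ⟨rfl, rfl⟩ | ⟨rfl, rfl⟩
    · exact h
    · exact adj2_symm h
  obtain ⟨i₁, j₁, a₁, d₁, hc₁, ha₁, hd₁, hs₁⟩ := ext e he
  obtain ⟨i₂, j₂, a₂, d₂, hc₂, ha₂, hd₂, hs₂⟩ := ext e' he'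
  obtain ⟨F, hF⟩ := cycle_F A D hA hD ha₁ ha₂ hd₁ hd₂ (sadj _ _ _ _ hc₁.adj hs₁)
    (sadj _ _ _ _ hc₂.adj hs₂)
  have dAB := Set.disjoint_left.1 hAB
  have dAD := Set.disjoint_left.1 hAD
  have dBD := Set.disjoint_left.1 hBD
  -- the value on `C`
  have hone : ∀ f ∈ C, bnd F f = if f = e then 1 else 0 := by
    intro f hf
    obtain ⟨i, j, hc, hh⟩ := ((memC f).1 hf).1
    rw [hF f i j hc, ← hs₁, ← hs₂, if_neg (c := s(i, j) = s(i₂, j₂)), add_zero]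
    · refine if_congr ⟨fun h => hc.inj hc₁ h, ?_⟩ rfl rfl
      rintro rfl
      obtain ⟨rfl, rfl⟩ := hc.uniq hc₁
      rfl
    · intro h
      exact he'C (hc.inj hc₂ h ▸ hf)
    · rintro ⟨h1, h2⟩
      rcases hh with hh | hh
      · exact dAD h2 hh.2
      · exact dAD h1 hh.2
    · rintro ⟨h1, h2⟩
      rcases hh with hh | hh
      · exact dAD hh.1 h1
      · exact dAD hh.1 h2
  have hB0 : ∀ e i j, Cross e i j → (i ∈ B ∨ j ∈ B) → bnd F e = 0 := by
    intro f i j hc hij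
    have hne : ∀ a ∈ A, ∀ d ∈ D, s(i, j) ≠ s(a, d) := by
      intro a ha d hd hs
      rcases Sym2.eq_iff.1 hs with ⟨rfl, rfl⟩ | ⟨rfl, rfl⟩
      · exact hij.elim (dAB ha) (fun h => dBD h hd)
      · exact hij.elim (fun h => dBD h hd) (dAB ha)
    rw [hF f i j hc, if_neg (hne _ ha₁ _ hd₁), if_neg (hne _ ha₂ _ hd₂), add_zero]
    · rintro ⟨h1, h2⟩
      exact hij.elim (dAB h1) (dAB h2)
    · rintro ⟨h1, h2⟩
      exact hij.elim (fun h => dBD h h1) (fun h => dBD h h2)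
  obtain ⟨c, hcB⟩ := const_on_B B hB F hB0
  set G : ℤ × ℤ → ZMod 2 := fun f => F f + c with hG
  have hGF : ∀ f ∈ C, bnd G f = bnd F f := by
    intro f hf
    obtain ⟨i, j, ⟨a, ⟨rfl, -⟩ | ⟨rfl, -⟩⟩, -⟩ := ((memC f).1 hf).1
    · rw [bnd_mk _ (by simp [Prod.ext_iff]), bnd_mk _ (by simp [Prod.ext_iff])]
      simp only [hG]
      linear_combination two0 c
    · rw [bnd_mk _ (by simp [Prod.ext_iff]), bnd_mk _ (by simp [Prod.ext_iff])]
      simp only [hG]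
      linear_combination two0 c
  have hsum1 : ∑ f ∈ C, bnd G f = 1 := by
    rw [Finset.sum_congr rfl fun f hf => (hGF f hf).trans (hone f hf), Finset.sum_ite_eq' C e,
      if_pos heC]
  have hsum0 : ∑ f ∈ C, bnd G f = 0 := by
    unfold bnd
    rw [Finset.sum_comm' (t' := C.biUnion fun f => f.toFinset)
      (s' := fun a => C.filter (fun f => a ∈ f))]
    · refine Finset.sum_eq_zero ?_
      rintro ⟨m, k⟩ -
      rw [Finset.sum_const, nsmul_eq_mul]
      by_cases hb : (m, k) ∈ B ∨ (m + 1, k) ∈ B ∨ (m, k + 1) ∈ B ∨ (m + 1, k + 1) ∈ B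
      · have : F (m, k) = c := by
          rcases hb with hb | hb | hb | hb
          · exact (hcB _ _ hb).1
          · simpa using (hcB _ _ hb).2.1
          · simpa using (hcB _ _ hb).2.2.1
          · simpa using (hcB _ _ hb).2.2.2
        simp [hG, this, two0]
      · push Not at hb
        by_cases hex : ∃ f ∈ C, (m, k) ∈ f
        · obtain ⟨f, hf, hmf⟩ := hex
          have hfilt : C.filter (fun f => (m, k) ∈ f) =
              ({s((m, k), (m + 1, k)), s((m - 1, k), (m, k)), s((m, k), (m, k + 1)),
                s((m, k - 1), (m, k))} : Finset (Sym2 (ℤ × ℤ))).filter (· ∈ cut A D) := by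
            ext g
            rw [Finset.mem_filter, Finset.mem_filter]
            constructor
            · rintro ⟨hg, hmg⟩
              have hg' := ((memC g).1 hg).1
              obtain ⟨i, j, hc, -⟩ := id hg'
              exact ⟨mem_four hc.isDualEdge hmg, hg'⟩
            · rintro ⟨hg, hg'⟩
              have hmg : (m, k) ∈ g := by
                simp only [Finset.mem_insert, Finset.mem_singleton] at hg
                rcases hg with rfl | rfl | rfl | rfl <;> simp
              refine ⟨(memC g).2 ⟨hg', ?_⟩, hmg⟩
              have h := (memC f).1 hf
              exact h.2.tail ⟨h.1, hg', (m, k), hmf, hmg⟩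
          rw [hfilt, parity A B D hAD hbd m k hb.1 hb.2.1 hb.2.2.1 hb.2.2.2, zero_mul]
        · rw [Finset.filter_eq_empty_iff.2 fun f hf h => hex ⟨f, hf, h⟩]
          simp
    · intro f a
      simp only [Finset.mem_filter, Finset.mem_biUnion, Sym2.mem_toFinset]
      constructor
      · rintro ⟨h1, h2⟩; exact ⟨⟨h1, h2⟩, f, h1, h2⟩
      · rintro ⟨h, -⟩; exact h
  rw [hsum1] at hsum0
  exact one_ne_zero hsum0

end CPC
namespace CPC

lemma rtg_symm {r : ℤ × ℤ → ℤ × ℤ → Prop} (hs : ∀ u v, r u v → r v u) {x y : ℤ × ℤ}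
    (h : Relation.ReflTransGen r x y) : Relation.ReflTransGen r y x := by
  induction h with
  | refl => exact Relation.ReflTransGen.refl
  | tail _ h ih => exact Relation.ReflTransGen.head (hs _ _ h) ih

lemma line_reach (r : ℤ × ℤ → ℤ × ℤ → Prop) (hs : ∀ u v, r u v → r v u) (f : ℤ → ℤ × ℤ)
    (h : ∀ t, r (f t) (f (t + 1))) (s t : ℤ) : Relation.ReflTransGen r (f s) (f t) := by
  have up : ∀ (s : ℤ) (n : ℕ), Relation.ReflTransGen r (f s) (f (s + n)) := by
    intro s n
    induction n with
    | zero => simpa using Relation.ReflTransGen.refl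
    | succ n ih =>
      refine ih.tail ?_
      have := h (s + n)
      push_cast
      rwa [← add_assoc]
  rcases le_total s t with hst | hst
  · have := up s (t - s).toNat
    rwa [Int.toNat_of_nonneg (by omega), add_sub_cancel] at this
  · have := up t (s - t).toNat
    rw [Int.toNat_of_nonneg (by omega), add_sub_cancel] at this
    exact rtg_symm hs this

/-- The outer lattice component of the complement of a finite set. -/
lemma exists_outer (U : Set (ℤ × ℤ)) (hU : U.Finite) :
    ∃ (D : Set (ℤ × ℤ)) (N : ℤ), Disjoint U D ∧ conn2 D ∧
      (∀ u ∈ D, ∀ v, adj2 u v → v ∉ U → v ∈ D) ∧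
      (∀ v : ℤ × ℤ, N < |v.1| ∨ N < |v.2| → v ∈ D) := by
  obtain ⟨N, hN0, hN⟩ : ∃ N : ℤ, 0 ≤ N ∧ ∀ v ∈ U, |v.1| ≤ N ∧ |v.2| ≤ N := by
    obtain ⟨N, hN⟩ := (hU.image fun v => max |v.1| |v.2|).bddAbove
    refine ⟨max N 0, le_max_right _ _, fun v hv => ?_⟩
    have := hN (Set.mem_image_of_mem _ hv)
    simp only [max_le_iff] at this
    exact ⟨this.1.trans (le_max_left _ _), this.2.trans (le_max_left _ _)⟩
  set r : ℤ × ℤ → ℤ × ℤ → Prop := fun u v => u ∉ U ∧ v ∉ U ∧ adj2 u v with hr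
  have rs : ∀ u v, r u v → r v u := fun u v h => ⟨h.2.1, h.1, adj2_symm h.2.2⟩
  have far : ∀ v : ℤ × ℤ, N < |v.1| ∨ N < |v.2| → v ∉ U := by
    intro v hv hvU
    have := hN v hvU
    omega
  have hN1 : N < |N + 1| := by rw [abs_of_nonneg] <;> omega
  have hor : ∀ y, N < |y| → ∀ s t, Relation.ReflTransGen r (s, y) (t, y) := by
    intro y hy s t
    refine line_reach r rs (fun s => (s, y)) (fun t => ⟨far _ (Or.inr hy), far _ (Or.inr hy), ?_⟩)
      s t
    simp [adj2]
  have ver : ∀ x, N < |x| → ∀ s t, Relation.ReflTransGen r (x, s) (x, t) := by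
    intro x hx s t
    refine line_reach r rs (fun s => (x, s)) (fun t => ⟨far _ (Or.inl hx), far _ (Or.inl hx), ?_⟩)
      s t
    simp [adj2]
  set p : ℤ × ℤ := (N + 1, N + 1) with hp
  have hpU : p ∉ U := far p (Or.inl hN1)
  refine ⟨{v | Relation.ReflTransGen r p v}, N, ?_, ?_, ?_, ?_⟩
  · rw [Set.disjoint_left]
    intro v hv hvD
    rcases Relation.ReflTransGen.cases_tail hvD with h | ⟨w, -, hw⟩
    · exact hpU (h ▸ hv)
    · exact hw.2.1 hv
  · have main : ∀ v, Relation.ReflTransGen r p v → Relation.ReflTransGen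
        (fun u v => u ∈ {v | Relation.ReflTransGen r p v} ∧
          v ∈ {v | Relation.ReflTransGen r p v} ∧ adj2 u v) p v := by
      intro v hv
      induction hv with
      | refl => exact Relation.ReflTransGen.refl
      | tail h1 h2 ih => exact ih.tail ⟨h1, h1.tail h2, h2.2.2⟩
    intro x hx y hy
    refine Relation.ReflTransGen.trans (rtg_symm ?_ (main x hx)) (main y hy)
    exact fun u v h => ⟨h.2.1, h.1, adj2_symm h.2.2⟩
  · intro u hu v hadj hv
    have huU : u ∉ U := by
      intro h
      rcases Relation.ReflTransGen.cases_tail hu with h' | ⟨w, -, hw⟩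
      · exact hpU (h' ▸ h)
      · exact hw.2.1 h
    exact Relation.ReflTransGen.tail hu ⟨huU, hv, hadj⟩
  · rintro ⟨x, y⟩ (h | h)
    · exact (hor (N + 1) hN1 (N + 1) x).trans (ver x h (N + 1) y)
    · exact (ver (N + 1) hN1 (N + 1) y).trans (hor y h (N + 1) x)

/-- The closed unit cell centred at `v`. -/
def cell (v : ℤ × ℤ) : Set (ℝ × ℝ) :=
  {x | |x.1 - (v.1 : ℝ)| ≤ 1 / 2 ∧ |x.2 - (v.2 : ℝ)| ≤ 1 / 2}

/-- The lattice point as a point of the plane. -/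
def cpt (v : ℤ × ℤ) : ℝ × ℝ := ((v.1 : ℝ), (v.2 : ℝ))

lemma mem_fat {S : Set (ℤ × ℤ)} {x : ℝ × ℝ} : x ∈ fat S ↔ ∃ v ∈ S, x ∈ cell v := Iff.rfl

lemma cell_eq (v : ℤ × ℤ) : cell v = Metric.closedBall (cpt v) (1 / 2) := by
  ext x
  simp only [Metric.mem_closedBall, Prod.dist_eq, Real.dist_eq, max_le_iff]
  rfl

lemma cell_closed (v : ℤ × ℤ) : IsClosed (cell v) := by
  rw [cell_eq]; exact Metric.isClosed_closedBall

lemma fat_closed (S : Set (ℤ × ℤ)) : IsClosed (fat S) := by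
  have : fat S = ⋃ v : S, cell v.1 := by
    ext x
    rw [mem_fat, Set.mem_iUnion]
    exact ⟨fun ⟨v, h, h'⟩ => ⟨⟨v, h⟩, h'⟩, fun ⟨v, h'⟩ => ⟨v.1, v.2, h'⟩⟩
  rw [this]
  refine LocallyFinite.isClosed_iUnion ?_ (fun v => cell_closed v.1)
  intro x
  refine ⟨Metric.ball x 1, Metric.ball_mem_nhds x one_pos, ?_⟩
  have hfin : (Set.Icc ((⌊x.1⌋ - 3, ⌊x.2⌋ - 3) : ℤ × ℤ) (⌊x.1⌋ + 3, ⌊x.2⌋ + 3)).Finite :=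
    Set.finite_Icc _ _
  refine Set.Finite.subset (hfin.preimage Subtype.val_injective.injOn) ?_
  rintro ⟨v, hv⟩ ⟨y, ⟨h1, h2⟩, hy⟩
  simp only [Metric.mem_ball, Prod.dist_eq, Real.dist_eq, max_lt_iff] at hy
  obtain ⟨h3, h4⟩ := hy
  rw [abs_le] at h1 h2
  rw [abs_lt] at h3 h4
  have f1 := Int.floor_le x.1
  have f2 := Int.lt_floor_add_one x.1
  have f3 := Int.floor_le x.2
  have f4 := Int.lt_floor_add_one x.2
  refine ⟨⟨?_, ?_⟩, ⟨?_, ?_⟩⟩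
  all_goals
    simp only
    have : ∀ a b : ℤ, (a : ℝ) ≤ b → a ≤ b := fun a b h => by exact_mod_cast h
    apply this
    push_cast
    linarith

lemma exists_cell (x : ℝ × ℝ) : ∃ v, x ∈ cell v :=
  ⟨(round x.1, round x.2), abs_sub_round x.1, abs_sub_round x.2⟩

lemma near_int {x : ℝ} {v w : ℤ} (h : |x - v| < 1 / 2) (h' : |x - w| ≤ 1 / 2) : v = w := by
  rw [abs_lt] at h
  rw [abs_le] at h'
  have h1 : v < w + 1 := by
    have : (v : ℝ) < w + 1 := by linarith
    exact_mod_cast this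
  have h2 : w < v + 1 := by
    have : (w : ℝ) < v + 1 := by linarith
    exact_mod_cast this
  omega

lemma ball_sub {S : Set (ℤ × ℤ)} {v : ℤ × ℤ} (h : v ∈ S) :
    Metric.ball (cpt v) (1 / 2) ⊆ (fat Sᶜ)ᶜ := by
  rintro x hx ⟨w, hw, h1, h2⟩
  simp only [Metric.mem_ball, Prod.dist_eq, Real.dist_eq, max_lt_iff] at hx
  have e1 := near_int hx.1 h1
  have e2 := near_int hx.2 h2
  have : v = w := Prod.ext e1 e2
  exact hw (this ▸ h)

lemma cell_sub_closure {S : Set (ℤ × ℤ)} {v : ℤ × ℤ} (h : v ∈ S) :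
    cell v ⊆ closure (fat Sᶜ)ᶜ := by
  rw [cell_eq, ← closure_ball _ (by norm_num)]
  exact closure_mono (ball_sub h)

lemma star1 {x t : ℝ} {v w : ℤ} (hx : |x - v| ≤ 1 / 2) (h0 : 0 ≤ t) (h1 : t ≤ 1)
    (hy : |(1 - t) * x + t * v - w| ≤ 1 / 2) : |x - w| ≤ 1 / 2 := by
  rcases lt_trichotomy v w with h | h | h
  · have hw : (v : ℝ) + 1 ≤ w := by exact_mod_cast h
    rw [abs_le] at *
    constructor <;> nlinarith
  · rw [← h]; exact hx
  · have hw : (w : ℝ) + 1 ≤ v := by exact_mod_cast h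
    rw [abs_le] at *
    constructor <;> nlinarith

lemma star_seg {S : Set (ℤ × ℤ)} {x : ℝ × ℝ} {v : ℤ × ℤ} (hx : x ∉ fat S) (hv : x ∈ cell v) :
    segment ℝ x (cpt v) ⊆ (fat S)ᶜ := by
  rintro y ⟨a, b, ha, hb, hab, rfl⟩ ⟨w, hw, h1, h2⟩
  obtain rfl : a = 1 - b := by linarith
  refine hx ⟨w, hw, star1 hv.1 hb (by linarith) h1, star1 hv.2 hb (by linarith) h2⟩

lemma comp_star {S : Set (ℤ × ℤ)} {x : ℝ × ℝ} {v : ℤ × ℤ} (hx : x ∉ fat S) (hv : x ∈ cell v) :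
    connectedComponentIn (fat S)ᶜ x = connectedComponentIn (fat S)ᶜ (cpt v) := by
  refine connectedComponentIn_eq ?_
  exact (convex_segment x (cpt v)).isPreconnected.subset_connectedComponentIn
    (left_mem_segment _ _ _) (star_seg hx hv) (right_mem_segment _ _ _)

/-- The midpoint of two lattice points. -/
noncomputable def mid (i j : ℤ × ℤ) : ℝ × ℝ :=
  (((i.1 : ℝ) + j.1) / 2, ((i.2 : ℝ) + j.2) / 2)

lemma mid_cell {i j : ℤ × ℤ} (h : adj2 i j) (w : ℤ × ℤ) :
    mid i j ∈ cell w ↔ w = i ∨ w = j := by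
  have key : ∀ a b : ℤ, |((a : ℝ)) / 2 - b| ≤ 1 / 2 ↔ (-1 ≤ a - 2 * b ∧ a - 2 * b ≤ 1) := by
    intro a b
    rw [abs_le]
    constructor
    · rintro ⟨h1, h2⟩
      constructor
      · have : ((-1 : ℤ) : ℝ) ≤ ((a - 2 * b : ℤ) : ℝ) := by push_cast; linarith
        exact_mod_cast this
      · have : ((a - 2 * b : ℤ) : ℝ) ≤ ((1 : ℤ) : ℝ) := by push_cast; linarith
        exact_mod_cast this
    · rintro ⟨h1, h2⟩
      have h1' : ((-1 : ℤ) : ℝ) ≤ ((a - 2 * b : ℤ) : ℝ) := by exact_mod_cast h1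
      have h2' : ((a - 2 * b : ℤ) : ℝ) ≤ ((1 : ℤ) : ℝ) := by exact_mod_cast h2
      push_cast at h1' h2'
      constructor <;> linarith
  have k1 := key (i.1 + j.1) w.1
  have k2 := key (i.2 + j.2) w.2
  push_cast at k1 k2
  simp only [cell, mid, Set.mem_ofPred_eq, k1, k2]
  obtain ⟨i1, i2⟩ := i
  obtain ⟨j1, j2⟩ := j
  obtain ⟨w1, w2⟩ := w
  simp only [adj2, Prod.mk.injEq] at *
  omega

lemma comp_adj {S : Set (ℤ × ℤ)} {u v : ℤ × ℤ} (hu : u ∉ S) (hv : v ∉ S) (h : adj2 u v) :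
    connectedComponentIn (fat S)ᶜ (cpt u) = connectedComponentIn (fat S)ᶜ (cpt v) := by
  have hm : mid u v ∉ fat S := by
    rintro ⟨w, hw, hc⟩
    rcases (mid_cell h w).1 hc with rfl | rfl
    · exact hu hw
    · exact hv hw
  rw [← comp_star hm ((mid_cell h u).2 (Or.inl rfl)), comp_star hm ((mid_cell h v).2 (Or.inr rfl))]

lemma cells_conn {x : ℝ × ℝ} {v w : ℤ × ℤ} {U D : Set (ℤ × ℤ)}
    (hcl : ∀ u ∈ D, ∀ v, adj2 u v → v ∉ U → v ∈ D) (hx : x ∉ fat U)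
    (hv : x ∈ cell v) (hw : x ∈ cell w) (hvD : v ∈ D) : w ∈ D := by
  have near : ∀ (y : ℝ) (a b : ℤ), |y - a| ≤ 1 / 2 → |y - b| ≤ 1 / 2 →
      a = b ∨ (a - b).natAbs = 1 := by
    intro y a b h1 h2
    rw [abs_le] at h1 h2
    have e1 : a ≤ b + 1 := by
      have : (a : ℝ) ≤ b + 1 := by linarith
      exact_mod_cast this
    have e2 : b ≤ a + 1 := by
      have : (b : ℝ) ≤ a + 1 := by linarith
      exact_mod_cast this
    omega
  have hu : x ∈ cell (v.1, w.2) := ⟨hv.1, hw.2⟩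
  have huD : (v.1, w.2) ∈ D := by
    rcases near _ _ _ hv.2 hw.2 with h | h
    · rw [← h]; exact hvD
    · exact hcl v hvD _ (by simp [adj2, h]) fun hh => hx ⟨_, hh, hu⟩
  rcases near _ _ _ hv.1 hw.1 with h | h
  · rw [h] at huD; exact huD
  · exact hcl _ huD _ (by simp [adj2, h]) fun hh => hx ⟨_, hh, hw⟩

lemma outer_eq (U D : Set (ℤ × ℤ)) (N : ℤ) (hUD : Disjoint U D) (hD : conn2 D)
    (hcl : ∀ u ∈ D, ∀ v, adj2 u v → v ∉ U → v ∈ D)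
    (hfar : ∀ v : ℤ × ℤ, N < |v.1| ∨ N < |v.2| → v ∈ D) :
    {x : ℝ × ℝ | x ∈ (fat U)ᶜ ∧ ¬ Bornology.IsBounded (connectedComponentIn (fat U)ᶜ x)} =
      (fat Dᶜ)ᶜ := by
  have dUD := Set.disjoint_left.1 hUD
  ext x
  constructor
  · rintro ⟨hxU, hxb⟩ hxD
    refine hxb ?_
    have cov : ∀ y, y ∈ (fat U)ᶜ → y ∈ fat Dᶜ → y ∈ (fat (D ∪ U))ᶜ := by
      rintro y hy ⟨w, hw, hyw⟩ ⟨v, hv | hv, hyv⟩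
      · exact hw (cells_conn hcl hy hyv hyw hv)
      · exact hy ⟨v, hv, hyv⟩
    have hsub : connectedComponentIn (fat U)ᶜ x ⊆ (fat (D ∪ U))ᶜ := by
      refine isPreconnected_connectedComponentIn.subset_left_of_subset_union
        (u := (fat (D ∪ U))ᶜ) (v := (fat Dᶜ)ᶜ)
        (fat_closed _).isOpen_compl (fat_closed _).isOpen_compl ?_ ?_ ?_
      · rw [Set.disjoint_left]
        intro y h1 h2
        obtain ⟨v, hv⟩ := exists_cell y
        by_cases hvD : v ∈ D
        · exact h1 ⟨v, Or.inl hvD, hv⟩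
        · exact h2 ⟨v, hvD, hv⟩
      · intro y hy
        have hy := connectedComponentIn_subset _ _ hy
        by_cases h : y ∈ fat Dᶜ
        · exact Or.inl (cov y hy h)
        · exact Or.inr h
      · exact ⟨x, mem_connectedComponentIn hxU, cov x hxU hxD⟩
    refine Bornology.IsBounded.subset (Metric.isBounded_closedBall (x := (0 : ℝ × ℝ))
      (r := (N : ℝ) + 1)) (hsub.trans ?_)
    intro y hy
    obtain ⟨v, hv⟩ := exists_cell y
    have hvD : v ∉ D := fun h => hy ⟨v, Or.inl h, hv⟩
    have : ¬ (N < |v.1| ∨ N < |v.2|) := fun h => hvD (hfar v h)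
    push Not at this
    obtain ⟨h1, h2⟩ := this
    have h1' : |(v.1 : ℝ)| ≤ N := by exact_mod_cast h1
    have h2' : |(v.2 : ℝ)| ≤ N := by exact_mod_cast h2
    obtain ⟨h3, h4⟩ := hv
    simp only [Metric.mem_closedBall, Prod.dist_eq, Real.dist_eq, max_le_iff, Prod.fst_zero,
      Prod.snd_zero, sub_zero]
    rw [abs_le] at *
    rw [abs_le]
    exact ⟨⟨by linarith, by linarith⟩, by linarith, by linarith⟩
  · intro hx
    have hxU : x ∉ fat U := by
      rintro ⟨v, hv, hxv⟩
      exact hx ⟨v, dUD hv, hxv⟩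
    refine ⟨hxU, fun hb => ?_⟩
    obtain ⟨v, hv⟩ := exists_cell x
    have hvD : v ∈ D := by
      by_contra h
      exact hx ⟨v, h, hv⟩
    rw [comp_star hxU hv] at hb
    have all : ∀ w ∈ D, connectedComponentIn (fat U)ᶜ (cpt v) =
        connectedComponentIn (fat U)ᶜ (cpt w) := by
      intro w hw
      have := hD v hvD w hw
      clear hw
      induction this with
      | refl => rfl
      | tail _ h ih =>
        exact ih.trans (comp_adj (fun hh => dUD hh h.1) (fun hh => dUD hh h.2.1) h.2.2)
    obtain ⟨R, hR⟩ := hb.subset_closedBall (0 : ℝ × ℝ)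
    set n : ℤ := max (N + 1) (⌈R⌉ + 1) with hn
    have hn0 : N < |n| := lt_of_lt_of_le (by omega) (le_abs_self n)
    have hnD : (n, (0 : ℤ)) ∈ D := hfar _ (Or.inl hn0)
    have hmem : cpt (n, 0) ∈ connectedComponentIn (fat U)ᶜ (cpt v) := by
      rw [all _ hnD]
      refine mem_connectedComponentIn ?_
      intro hf
      refine ball_sub hnD (Metric.mem_ball_self (by norm_num)) ?_
      obtain ⟨w, hw, hc⟩ := hf
      exact ⟨w, dUD hw, hc⟩
    have := hR hmem
    simp only [Metric.mem_closedBall, Prod.dist_eq, Real.dist_eq, max_le_iff, Prod.fst_zero,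
      Prod.snd_zero, sub_zero, cpt] at this
    have h1 : (n : ℝ) ≤ R := (le_abs_self _).trans this.1
    have h2 : ((⌈R⌉ + 1 : ℤ) : ℝ) ≤ n := by exact_mod_cast le_max_right _ _
    have h3 := Int.le_ceil R
    push_cast at h2
    linarith

lemma seg_cell {e : Sym2 (ℤ × ℤ)} {i j : ℤ × ℤ} (h : Cross e i j) {x : ℝ × ℝ}
    (hx : x ∈ edgeSeg e) : x ∈ cell i ∧ x ∈ cell j := by
  have hconv : ∀ v, Convex ℝ (cell v) := fun v => by rw [cell_eq]; exact convex_closedBall _ _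
  obtain ⟨p, q, rfl, hx⟩ := hx
  have key : (dualPos p ∈ cell i ∧ dualPos q ∈ cell i) ∧ (dualPos p ∈ cell j ∧ dualPos q ∈ cell j) := by
    obtain ⟨⟨a1, a2⟩, ⟨h, rfl, rfl⟩ | ⟨h, rfl, rfl⟩⟩ := h <;>
    rcases Sym2.eq_iff.1 h with ⟨rfl, rfl⟩ | ⟨rfl, rfl⟩ <;>
    simp only [cell, dualPos, Set.mem_ofPred_eq, abs_le] <;> push_cast <;>
    refine ⟨⟨⟨⟨?_, ?_⟩, ?_, ?_⟩, ⟨?_, ?_⟩, ?_, ?_⟩, ⟨⟨?_, ?_⟩, ?_, ?_⟩, ⟨?_, ?_⟩, ?_, ?_⟩ <;> linarith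
  exact ⟨(hconv i).segment_subset key.1.1 key.1.2 hx, (hconv j).segment_subset key.2.1 key.2.2 hx⟩

lemma mid_seg {e : Sym2 (ℤ × ℤ)} {i j : ℤ × ℤ} (h : Cross e i j) : mid i j ∈ edgeSeg e := by
  obtain ⟨⟨a1, a2⟩, ⟨rfl, rfl, rfl⟩ | ⟨rfl, rfl, rfl⟩⟩ := h <;>
  refine ⟨_, _, rfl, 1 / 2, 1 / 2, by norm_num, by norm_num, by norm_num, ?_⟩ <;>
  simp only [mid, dualPos, Prod.smul_mk, Prod.mk_add_mk, smul_eq_mul, Prod.mk.injEq] <;>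
  push_cast <;> constructor <;> ring

lemma frontier_iff (U D : Set (ℤ × ℤ)) (hUD : Disjoint U D)
    (hcl : ∀ u ∈ D, ∀ v, adj2 u v → v ∉ U → v ∈ D) {e : Sym2 (ℤ × ℤ)} {i j : ℤ × ℤ}
    (h : Cross e i j) :
    edgeSeg e ⊆ frontier (fat Dᶜ)ᶜ ↔ (i ∈ U ∧ j ∈ D ∨ j ∈ U ∧ i ∈ D) := by
  have dUD := Set.disjoint_left.1 hUD
  rw [(fat_closed Dᶜ).isOpen_compl.frontier_eq]
  constructor
  · intro hs
    obtain ⟨h1, h2⟩ := hs (mid_seg h)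
    have hor : i ∈ D ∨ j ∈ D := by
      by_contra hno
      push Not at hno
      have hsub : closure (fat Dᶜ)ᶜ ⊆ fat D := by
        refine closure_minimal ?_ (fat_closed D)
        intro y hy
        obtain ⟨v, hv⟩ := exists_cell y
        by_contra hyD
        exact hy ⟨v, fun hvD => hyD ⟨v, hvD, hv⟩, hv⟩
      obtain ⟨w, hw, hc⟩ := hsub h1
      rcases (mid_cell h.adj w).1 hc with rfl | rfl
      · exact hno.1 hw
      · exact hno.2 hw
    have hnand : ¬ (i ∈ D ∧ j ∈ D) := by
      rintro ⟨hi, hj⟩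
      refine h2 ?_
      rintro ⟨w, hw, hc⟩
      rcases (mid_cell h.adj w).1 hc with rfl | rfl
      · exact hw hi
      · exact hw hj
    rcases hor with hi | hj
    · right
      refine ⟨?_, hi⟩
      by_contra hjU
      exact hnand ⟨hi, hcl i hi j h.adj hjU⟩
    · left
      refine ⟨?_, hj⟩
      by_contra hiU
      exact hnand ⟨hcl j hj i (adj2_symm h.adj) hiU, hj⟩
  · rintro (⟨hi, hj⟩ | ⟨hi, hj⟩) x hx <;> obtain ⟨hxi, hxj⟩ := seg_cell h hx
    · exact ⟨cell_sub_closure hj hxj, fun hh => hh ⟨i, dUD hi, hxi⟩⟩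
    · exact ⟨cell_sub_closure hj hxi, fun hh => hh ⟨j, dUD hi, hxj⟩⟩

lemma contour_eq (U A D : Set (ℤ × ℤ)) (hAU : A ⊆ U) (hUD : Disjoint U D)
    (hcl : ∀ u ∈ D, ∀ v, adj2 u v → v ∉ U → v ∈ D) :
    {e | IsDualEdge e ∧ edgeSeg e ⊆ frontier (fat Dᶜ)ᶜ} ∩
      {e | IsDualEdge e ∧ (sMap e ∩ A).Nonempty} = cut A D := by
  have dUD := Set.disjoint_left.1 hUD
  ext e
  constructor
  · rintro ⟨⟨he, hs⟩, -, v, hv, hvA⟩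
    obtain ⟨i, j, hc⟩ := cross_of_dualEdge he
    rw [frontier_iff U D hUD hcl hc] at hs
    rw [hc.sMap] at hv
    rw [mem_cut hc]
    rcases hv with rfl | hv
    · rcases hs with ⟨h1, h2⟩ | ⟨h1, h2⟩
      · exact Or.inl ⟨hvA, h2⟩
      · exact absurd h2 (dUD (hAU hvA))
    · obtain rfl : v = j := hv
      rcases hs with ⟨h1, h2⟩ | ⟨h1, h2⟩
      · exact absurd h2 (dUD (hAU hvA))
      · exact Or.inr ⟨hvA, h2⟩
  · rintro ⟨i, j, hc, hh⟩
    refine ⟨⟨hc.isDualEdge, (frontier_iff U D hUD hcl hc).2 ?_⟩, hc.isDualEdge, ?_⟩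
    · exact hh.imp (fun h => ⟨hAU h.1, h.2⟩) (fun h => ⟨hAU h.1, h.2⟩)
    · rw [hc.sMap]
      rcases hh with h | h
      · exact ⟨i, by simp, h.1⟩
      · exact ⟨j, by simp, h.1⟩

end CPC

theorem contour_pieces_connected (A B : Set (ℤ × ℤ)) (hA : A.Finite) (hB : B.Finite)
    (hAB : Disjoint A B) (hAconn : conn2 A) (hBconn : conn2 B) (hUconn : conn2 (A ∪ B))
    (Γ : Set (Sym2 (ℤ × ℤ)))
    -- `Γ` is the set of dual edges forming the boundary of the unbounded
    -- connected component of the complement of `(A ∪ B) + [−1/2,1/2]²` in `ℝ²`: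
    (hΓ : Γ = {e | IsDualEdge e ∧ edgeSeg e ⊆
      frontier {x : ℝ × ℝ | x ∈ (fat (A ∪ B))ᶜ ∧
        ¬ Bornology.IsBounded (connectedComponentIn (fat (A ∪ B))ᶜ x)}}) :
    edgeConn (Γ ∩ {e | IsDualEdge e ∧ (sMap e ∩ A).Nonempty}) ∧
    edgeConn (Γ ∩ {e | IsDualEdge e ∧ (sMap e ∩ B).Nonempty}) := by
  obtain ⟨D, N, hUD, hD, hcl, hfar⟩ := CPC.exists_outer (A ∪ B) (hA.union hB)
  rw [CPC.outer_eq (A ∪ B) D N hUD hD hcl hfar] at hΓ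
  have hbd : ∀ u ∈ D, ∀ v, adj2 u v → v ∉ D → v ∈ A ∪ B := by
    intro u hu v hadj hv
    by_contra h
    exact hv (hcl u hu v hadj h)
  have hAD : Disjoint A D := hUD.mono_left Set.subset_union_left
  have hBD : Disjoint B D := hUD.mono_left Set.subset_union_right
  subst hΓ
  rw [CPC.contour_eq (A ∪ B) A D Set.subset_union_left hUD hcl,
    CPC.contour_eq (A ∪ B) B D Set.subset_union_right hUD hcl]
  refine ⟨CPC.cut_conn A B D hA hAconn hBconn hD hAB hAD hBD hbd,
    CPC.cut_conn B A D hB hBconn hAconn hD hAB.symm hBD hAD ?_⟩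
  rw [Set.union_comm]
  exact hbd
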